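/- In the directed Chung-Lu model, if a·b/S > 1 then for every integer r ≥ 1 the variance of the number of present simple cycles of length r satisfies Var(SC_r) ≤ E[SC_r] · [ r + (a·b/S)^r · ( exp( p_max·(rS/(a·b))² / (1 − S/(a·b)) ) − 1 ) ]. -/

import Mathlib

open Finset

noncomputable section
open scoped Classical

/-- Probability of observing the edge configuration `ω` when the directed edge `(i,j)`
is present independently with probability `p i j`. -/
def configProb (N : ℕ) (p : Fin N → Fin N → ℝ) (ω : Fin N → Fin N → Bool) : ℝ :=
  ∏ i : Fin N, ∏ j : Fin N, if ω i j then p i j else 1 - p i j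

/-- Expectation of the functional `f` of the random edge configuration. -/
def expect (N : ℕ) (p : Fin N → Fin N → ℝ) (f : (Fin N → Fin N → Bool) → ℝ) : ℝ :=
  ∑ ω : Fin N → Fin N → Bool, configProb N p ω * f ω

/-- Variance of a real functional of the random edge configuration. -/
def varOf (N : ℕ) (p : Fin N → Fin N → ℝ) (f : (Fin N → Fin N → Bool) → ℝ) : ℝ :=
  expect N p (fun ω => (f ω - expect N p f) ^ 2)

/-- Number of present simple cycles of length `r`, counted with their cyclic rotations. -/
def simpleCycleCount (N r : ℕ) (ω : Fin N → Fin N → Bool) : ℕ :=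
  (Finset.univ.filter (fun c : Fin r → Fin N =>
      Function.Injective c ∧ ∀ k : Fin r, ω (c k) (c (finRotate r k)) = true)).card

/-- Expectations of products of edge indicators factor over a finite edge set. -/
theorem expect_edge_indicator (N : ℕ) (p : Fin N → Fin N → ℝ) (F : Finset (Fin N × Fin N)) :
    expect N p (fun ω => if ∀ e ∈ F, ω e.1 e.2 = true then 1 else 0) = ∏ e ∈ F, p e.1 e.2 := by
  have hsum : ∀ f : Fin N → Fin N → Bool → ℝ,
      ∑ ω : Fin N → Fin N → Bool, ∏ i, ∏ j, f i j (ω i j) = ∏ i, ∏ j, ∑ x, f i j x := by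
    intro f
    have h1 : ∀ i, ∏ j, ∑ x, f i j x = ∑ v : Fin N → Bool, ∏ j, f i j (v j) := by
      intro i
      rw [Finset.prod_univ_sum, Fintype.piFinset_univ]
    simp_rw [h1]
    rw [Finset.prod_univ_sum, Fintype.piFinset_univ]
  have hind : ∀ ω : Fin N → Fin N → Bool,
      (if ∀ e ∈ F, ω e.1 e.2 = true then (1 : ℝ) else 0)
        = ∏ i, ∏ j, if (i, j) ∈ F then (if ω i j = true then (1 : ℝ) else 0) else 1 := by
    intro ω
    rw [← Fintype.prod_prod_type'
      (f := fun i j => if (i, j) ∈ F then (if ω i j = true then (1 : ℝ) else 0) else 1)]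
    rw [Finset.prod_ite_mem, Finset.univ_inter]
    split_ifs with h
    · exact (Finset.prod_eq_one fun e he => if_pos (h e he)).symm
    · push Not at h
      obtain ⟨e, he, hω⟩ := h
      exact (Finset.prod_eq_zero he (if_neg hω)).symm
  unfold _root_.expect configProb
  simp_rw [hind, ← Finset.prod_mul_distrib]
  rw [hsum fun i j x => (if x then p i j else 1 - p i j) *
    (if (i, j) ∈ F then (if x = true then (1 : ℝ) else 0) else 1)]
  rw [← Fintype.prod_prod_type' (f := fun i j => ∑ x : Bool, (if x then p i j else 1 - p i j) *
    (if (i, j) ∈ F then (if x = true then (1 : ℝ) else 0) else 1))]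
  calc _ = ∏ e : Fin N × Fin N, if e ∈ F then p e.1 e.2 else 1 := by
        refine Finset.prod_congr rfl fun e _ => ?_
        by_cases he : e ∈ F <;> simp [he]
    _ = _ := by rw [Finset.prod_ite_mem, Finset.univ_inter]

/-- The set of edges of the closed walk `c`, whose successor structure is the permutation `σ`. -/
def edgeSet {N r : ℕ} (σ : Equiv.Perm (Fin r)) (c : Fin r → Fin N) : Finset (Fin N × Fin N) :=
  univ.image fun k => (c k, c (σ k))

theorem mem_edgeSet {N r : ℕ} {σ : Equiv.Perm (Fin r)} {c : Fin r → Fin N} {e : Fin N × Fin N} :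
    e ∈ edgeSet σ c ↔ ∃ k, (c k, c (σ k)) = e := by
  simp [edgeSet]

/-- The positions at which the closed walk `c'` uses an edge of `c`. -/
def sharedPositions {N r : ℕ} (σ : Equiv.Perm (Fin r)) (c c' : Fin r → Fin N) : Finset (Fin r) :=
  univ.filter fun k => (c' k, c' (σ k)) ∈ edgeSet σ c

theorem expect_sum {α : Type*} (N : ℕ) (p : Fin N → Fin N → ℝ) (s : Finset α)
    (f : α → (Fin N → Fin N → Bool) → ℝ) :
    expect N p (fun ω => ∑ c ∈ s, f c ω) = ∑ c ∈ s, expect N p (f c) := by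
  unfold _root_.expect
  simp_rw [Finset.mul_sum]
  exact Finset.sum_comm

theorem varOf_eq_sub (N : ℕ) (p : Fin N → Fin N → ℝ) (f : (Fin N → Fin N → Bool) → ℝ) :
    varOf N p f = expect N p (fun ω => f ω * f ω) - expect N p f * expect N p f := by
  have h1 : ∑ ω, configProb N p ω = 1 := by
    simpa [_root_.expect] using expect_edge_indicator N p ∅
  unfold varOf
  set m := expect N p f with hm
  have : ∀ ω, configProb N p ω * (f ω - m) ^ 2 = configProb N p ω * (f ω * f ω)
      - 2 * m * (configProb N p ω * f ω) + m ^ 2 * configProb N p ω := fun ω => by ring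
  unfold _root_.expect at hm ⊢
  simp_rw [this]
  rw [Finset.sum_add_distrib, Finset.sum_sub_distrib, ← Finset.mul_sum, ← Finset.mul_sum, h1, ← hm]
  ring

theorem simpleCycleCount_eq_sum (N r : ℕ) (ω : Fin N → Fin N → Bool) :
    (simpleCycleCount N r ω : ℝ) =
      ∑ c ∈ univ.filter (fun c : Fin r → Fin N => Function.Injective c),
        if ∀ e ∈ edgeSet (finRotate r) c, ω e.1 e.2 = true then (1 : ℝ) else 0 := by
  rw [simpleCycleCount, ← Finset.filter_filter, Finset.card_filter]
  push_cast
  refine Finset.sum_congr rfl fun c _ => ?_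
  congr 1
  simp [mem_edgeSet]

theorem expect_simpleCycleCount (N r : ℕ) (p : Fin N → Fin N → ℝ) :
    expect N p (fun ω => (simpleCycleCount N r ω : ℝ)) =
      ∑ c ∈ univ.filter (fun c : Fin r → Fin N => Function.Injective c),
        ∏ e ∈ edgeSet (finRotate r) c, p e.1 e.2 := by
  simp_rw [simpleCycleCount_eq_sum, expect_sum, expect_edge_indicator]

theorem varOf_simpleCycleCount (N r : ℕ) (p : Fin N → Fin N → ℝ) :
    varOf N p (fun ω => (simpleCycleCount N r ω : ℝ)) =
      ∑ c ∈ univ.filter (fun c : Fin r → Fin N => Function.Injective c),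
        ∑ c' ∈ univ.filter (fun c : Fin r → Fin N => Function.Injective c),
          (∏ e ∈ edgeSet (finRotate r) c ∪ edgeSet (finRotate r) c', p e.1 e.2
            - (∏ e ∈ edgeSet (finRotate r) c, p e.1 e.2)
              * ∏ e ∈ edgeSet (finRotate r) c', p e.1 e.2) := by
  rw [varOf_eq_sub, expect_simpleCycleCount, Finset.sum_mul_sum]
  simp_rw [Finset.sum_sub_distrib]
  congr 1
  simp_rw [simpleCycleCount_eq_sum, Finset.sum_mul_sum, expect_sum]
  refine Finset.sum_congr rfl fun c _ => Finset.sum_congr rfl fun c' _ => ?_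
  rw [← expect_edge_indicator]
  congr 1
  funext ω
  rw [ite_zero_mul_ite_zero, mul_one]
  congr 1
  simp only [Finset.mem_union, or_imp, forall_and]

theorem prod_edgeSet_sdiff {N r : ℕ} (σ : Equiv.Perm (Fin r)) (p : Fin N → Fin N → ℝ)
    (c c' : Fin r → Fin N) (hc' : Function.Injective c') :
    ∏ e ∈ edgeSet σ c' \ edgeSet σ c, p e.1 e.2 =
      ∏ k, if k ∈ sharedPositions σ c c' then 1 else p (c' k) (c' (σ k)) := by
  have : edgeSet σ c' \ edgeSet σ c
      = (univ.filter fun k => ¬ k ∈ sharedPositions σ c c').image fun k => (c' k, c' (σ k)) := by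
    ext e
    simp only [Finset.mem_sdiff, mem_edgeSet (c := c'), Finset.mem_image, Finset.mem_filter,
      Finset.mem_univ, true_and, sharedPositions]
    constructor
    · rintro ⟨⟨k, rfl⟩, h⟩
      exact ⟨k, h, rfl⟩
    · rintro ⟨k, h, rfl⟩
      exact ⟨⟨k, rfl⟩, h⟩
  rw [this, Finset.prod_image, Finset.prod_filter]
  · exact Finset.prod_congr rfl fun k _ => by split_ifs <;> simp_all
  · intro x _ y _ h
    exact hc' (congrArg Prod.fst h)

theorem finRotate_induction {r : ℕ} {P : Fin r → Prop} {k₀ : Fin r} (h₀ : P k₀)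
    (h : ∀ k, P k → P (finRotate r k)) (k : Fin r) : P k := by
  cases r with
  | zero => exact k.elim0
  | succ n =>
    have key : ∀ m : ℕ, P (k₀ + Fin.ofNat (n + 1) m) := by
      intro m
      induction m with
      | zero => simpa using h₀
      | succ m ih =>
        have := h _ ih
        rw [finRotate_apply] at this
        convert this using 1
        rw [add_assoc]
        congr 1
        ext
        simp [Fin.val_add]
    have := key (k - k₀).val
    simpa using this

/-- Two closed walks with the same shared positions agree once they agree at one point and at all
positions which are not preceded by a shared position. -/
theorem eq_of_agree {N r : ℕ} {c c₁ c₂ : Fin r → Fin N} (hc : Function.Injective c)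
    {T : Finset (Fin r)} (h₁ : sharedPositions (finRotate r) c c₁ = T)
    (h₂ : sharedPositions (finRotate r) c c₂ = T) {k₀ : Fin r} (h₀ : c₁ k₀ = c₂ k₀)
    (h : ∀ k, k ∉ T → c₁ (finRotate r k) = c₂ (finRotate r k)) : c₁ = c₂ := by
  funext k
  refine finRotate_induction (P := fun k => c₁ k = c₂ k) h₀ (fun k hk => ?_) k
  by_cases hT : k ∈ T
  · have e₁ : k ∈ sharedPositions (finRotate r) c c₁ := h₁ ▸ hT
    have e₂ : k ∈ sharedPositions (finRotate r) c c₂ := h₂ ▸ hT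
    simp only [sharedPositions, Finset.mem_filter, Finset.mem_univ, true_and, mem_edgeSet,
      Prod.mk.injEq] at e₁ e₂
    obtain ⟨i, hi, hi'⟩ := e₁
    obtain ⟨j, hj, hj'⟩ := e₂
    have : i = j := hc (by rw [hi, hj, hk])
    rw [← hi', ← hj', this]
  · exact h k hT

theorem card_shared_univ_le {N r : ℕ} (hr : 1 ≤ r) {c : Fin r → Fin N} (hc : Function.Injective c) :
    (univ.filter fun c' : Fin r → Fin N =>
      sharedPositions (finRotate r) c c' = univ).card ≤ r := by
  have k₀ : Fin r := ⟨0, hr⟩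
  have : (univ.image c).card = r := by
    rw [Finset.card_image_of_injective _ hc, Finset.card_univ, Fintype.card_fin]
  refine (Finset.card_le_card_of_injOn (t := univ.image c) (fun c' => c' k₀) (fun c' h => ?_)
    fun c₁ h₁ c₂ h₂ h => ?_).trans this.le
  · simp only [Finset.coe_filter, Finset.mem_univ, true_and, Set.mem_ofPred_eq] at h
    have hk : k₀ ∈ sharedPositions (finRotate r) c c' := h ▸ Finset.mem_univ _
    simp only [sharedPositions, Finset.mem_filter, Finset.mem_univ, true_and, mem_edgeSet,
      Prod.mk.injEq] at hk
    obtain ⟨i, hi, -⟩ := hk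
    simp only [Finset.coe_image, Finset.coe_univ, Set.image_univ]
    exact ⟨i, hi⟩
  · simp only [Finset.coe_filter, Finset.mem_univ, true_and, Set.mem_ofPred_eq] at h₁ h₂
    exact eq_of_agree hc h₁ h₂ h fun k hk => (hk (Finset.mem_univ k)).elim

/-- The positions of `T` which start a maximal arc. -/
def arcStarts {r : ℕ} (σ : Equiv.Perm (Fin r)) (T : Finset (Fin r)) : Finset (Fin r) :=
  univ.filter fun k => k ∈ T ∧ σ.symm k ∉ T

theorem card_arcEnds {r : ℕ} (σ : Equiv.Perm (Fin r)) (T : Finset (Fin r)) :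
    (univ.filter fun k => k ∉ T ∧ σ.symm k ∈ T).card = (arcStarts σ T).card := by
  have h1 : (univ.filter fun k => k ∉ T ∧ σ.symm k ∈ T) = T.map σ.toEmbedding \ T := by
    ext k
    simp [Finset.mem_map_equiv, and_comm]
  have h2 : arcStarts σ T = T \ T.map σ.toEmbedding := by
    ext k
    simp [arcStarts, Finset.mem_map_equiv]
  rw [h1, h2]
  exact Finset.card_sdiff_comm (Finset.card_map _)

/-- Total weight of the cycles whose set of positions shared with `c` is exactly `T`. -/
theorem sum_shared_eq_le {N r : ℕ} {a b : Fin N → ℝ} {S M₁ M₂ : ℝ} (ha : ∀ i, 0 ≤ a i)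
    (hb : ∀ i, 0 ≤ b i) (hS : 0 < S) (hM₁ : ∀ i, a i ≤ M₁) (hM₂ : ∀ i, b i ≤ M₂)
    {d : ℝ} (hd : d = (∑ i, a i * b i) / S) (hd0 : 0 < d)
    {c : Fin r → Fin N} (hc : Function.Injective c) {T : Finset (Fin r)} (hT : T ≠ univ) :
    ∑ c' ∈ univ.filter (fun c' : Fin r → Fin N => sharedPositions (finRotate r) c c' = T),
      ∏ k, (if k ∈ T then 1 else b (c' k) * a (c' (finRotate r k)) / S) ≤
      d ^ r * ((r * M₁ * M₂ / (S * d)) ^ (arcStarts (finRotate r) T).card * d⁻¹ ^ T.card) := by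
  set σ := finRotate r with hσ
  obtain ⟨k₀, hk₀⟩ : ∃ k, k ∉ T := by
    by_contra! h
    exact hT (Finset.eq_univ_of_forall h)
  set v₀ := c k₀
  have hM₁0 : 0 ≤ M₁ := (ha v₀).trans (hM₁ v₀)
  have hM₂0 : 0 ≤ M₂ := (hb v₀).trans (hM₂ v₀)
  let t : Fin r → Finset (Fin N) := fun k =>
    if σ.symm k ∈ T then {v₀} else if k ∈ T then univ.image c else univ
  let w : Fin r → Fin N → ℝ := fun k v =>
    if σ.symm k ∈ T then (if k ∈ T then 1 else M₂ / S) else if k ∈ T then M₁ else a v * b v / S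
  let φ : (Fin r → Fin N) → (Fin r → Fin N) := fun c' k => if σ.symm k ∈ T then v₀ else c' k
  have hw : ∀ k v, 0 ≤ w k v := by
    intro k v
    have := ha v
    have := hb v
    simp only [w]
    split_ifs <;> positivity
  calc _ ≤ ∑ c' ∈ univ.filter (fun c' : Fin r → Fin N => sharedPositions σ c c' = T),
        ∏ k, w k (φ c' k) := by
        refine Finset.sum_le_sum fun c' _ => ?_
        have e : ∏ k, (if k ∈ T then 1 else b (c' k) * a (c' (σ k)) / S)
            = ∏ k, (if k ∈ T then 1 else b (c' k) / S) * (if σ.symm k ∈ T then 1 else a (c' k)) := by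
          have : ∏ k, (if σ.symm k ∈ T then 1 else a (c' k))
              = ∏ k, (if k ∈ T then 1 else a (c' (σ k))) := by
            rw [← Equiv.prod_comp σ]
            simp
          rw [Finset.prod_mul_distrib, this, ← Finset.prod_mul_distrib]
          refine Finset.prod_congr rfl fun k _ => ?_
          split_ifs <;> ring
        rw [e]
        refine Finset.prod_le_prod (fun k _ => ?_) fun k _ => ?_
        · have := ha (c' k)
          have := hb (c' k)
          split_ifs <;> positivity
        · simp only [w, φ]
          split_ifs
          · simp
          · simpa using hM₁ _
          · have := hM₂ (c' k)
            rw [mul_one]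
            gcongr
          · exact le_of_eq (by ring)
    _ = ∑ g ∈ (univ.filter (fun c' : Fin r → Fin N => sharedPositions σ c c' = T)).image φ,
        ∏ k, w k (g k) := by
        rw [Finset.sum_image]
        intro c₁ h₁ c₂ h₂ h
        simp only [Finset.coe_filter, Finset.mem_univ, true_and, Set.mem_ofPred_eq] at h₁ h₂
        have hstep : ∀ k, k ∉ T → c₁ (σ k) = c₂ (σ k) := by
          intro k hk
          have := congrFun h (σ k)
          simpa [φ, hk] using this
        exact eq_of_agree hc h₁ h₂ (hstep k₀ hk₀) hstep
    _ ≤ ∑ g ∈ Fintype.piFinset t, ∏ k, w k (g k) := by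
        refine Finset.sum_le_sum_of_subset_of_nonneg ?_
          fun g _ _ => Finset.prod_nonneg fun k _ => hw k _
        intro g hg
        obtain ⟨c', hc', rfl⟩ := Finset.mem_image.1 hg
        have hc'T := (Finset.mem_filter.1 hc').2
        rw [Fintype.mem_piFinset]
        intro k
        simp only [t, φ]
        split_ifs with h1 h2
        · simp
        · rw [← hc'T] at h2
          simp only [sharedPositions, Finset.mem_filter, Finset.mem_univ, true_and, mem_edgeSet,
            Prod.mk.injEq] at h2
          obtain ⟨i, hi, -⟩ := h2
          exact Finset.mem_image.2 ⟨i, Finset.mem_univ _, hi⟩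
        · simp
    _ = ∏ k, ∑ v ∈ t k, w k v := by rw [Finset.prod_univ_sum]
    _ = ∏ k, d * ((if k ∈ T then d⁻¹ else 1) * ((if k ∈ T ∧ σ.symm k ∉ T then r * M₁ else 1) *
          (if k ∉ T ∧ σ.symm k ∈ T then M₂ / (S * d) else 1))) := by
        refine Finset.prod_congr rfl fun k _ => ?_
        have hcard : (univ.image c).card = r := by
          rw [Finset.card_image_of_injective _ hc, Finset.card_univ, Fintype.card_fin]
        by_cases h1 : σ.symm k ∈ T <;> by_cases h2 : k ∈ T
        · simp [t, w, h1, h2, hd0.ne']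
        · simp [t, w, h1, h2]
          field_simp
        · simp only [t, w, h1, h2, if_true, if_false, Finset.sum_const, hcard, nsmul_eq_mul]
          simp [hd0.ne']
        · simp only [t, w, h1, h2, if_false]
          simp [hd, Finset.sum_div]
    _ = d ^ r * (d⁻¹ ^ T.card * ((r * M₁) ^ (arcStarts σ T).card *
          (M₂ / (S * d)) ^ (arcStarts σ T).card)) := by
        simp_rw [Finset.prod_mul_distrib, Finset.prod_ite, Finset.prod_const_one, mul_one,
          Finset.prod_const, card_arcEnds]
        simp [arcStarts]
    _ = _ := by
        rw [← mul_pow]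
        ring_nf

/-- The weighted count of proper nonempty subsets of a cycle by size and number of arcs. -/
theorem sum_arcs_le {r : ℕ} {y q : ℝ} (hy : 0 ≤ y) (hq0 : 0 ≤ q) (hq1 : q < 1) :
    ∑ T ∈ univ.filter (fun T : Finset (Fin r) => T ≠ ∅ ∧ T ≠ univ),
      y ^ (arcStarts (finRotate r) T).card * q ^ T.card ≤ Real.exp (r * (y * q / (1 - q))) - 1 := by
  set σ := finRotate r with hσ
  set 𝒯 := univ.filter (fun T : Finset (Fin r) => T ≠ ∅ ∧ T ≠ univ) with h𝒯
  have hg : ∀ T : Finset (Fin r), T ∈ 𝒯 →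
      ∃ g : Fin r → ℕ, ∀ k, g k = if k ∈ T then g (σ k) + 1 else 0 := by
    intro T hT
    have hex : ∀ k, ∃ n : ℕ, (σ ^ n) k ∉ T := by
      intro k
      by_contra! h
      refine (Finset.mem_filter.1 hT).2.2 (Finset.eq_univ_of_forall fun j => ?_)
      have : ∃ n : ℕ, (σ ^ n) k = j := by
        refine finRotate_induction (P := fun j => ∃ n : ℕ, (σ ^ n) k = j) (k₀ := k) ⟨0, rfl⟩ ?_ j
        rintro _ ⟨n, rfl⟩
        exact ⟨n + 1, by rw [pow_succ']; rfl⟩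
      obtain ⟨n, rfl⟩ := this
      exact h n
    refine ⟨fun k => Nat.find (hex k), fun k => ?_⟩
    split_ifs with hk
    · rw [Nat.find_eq_iff]
      refine ⟨?_, fun n hn => ?_⟩
      · have := Nat.find_spec (hex (σ k))
        rwa [pow_succ]
      · cases n with
        | zero => simpa using hk
        | succ n =>
          have := Nat.find_min (hex (σ k)) (Nat.lt_of_succ_lt_succ hn)
          rwa [pow_succ]
    · rw [Nat.find_eq_zero]
      simpa using hk
  choose! g hg using hg
  let L : Finset (Fin r) → Fin r → ℕ := fun T k => if σ.symm k ∈ T then 0 else g T k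
  have hpos : ∀ T ∈ 𝒯, ∀ k, k ∈ T ↔ g T k ≠ 0 := by
    intro T hT k
    rw [hg T hT k]
    by_cases hk : k ∈ T <;> simp [hk]
  have hL0 : ∀ T ∈ 𝒯, ∀ k, L T k ≠ 0 ↔ k ∈ arcStarts σ T := by
    intro T hT k
    simp only [L, arcStarts, Finset.mem_filter, Finset.mem_univ, true_and]
    by_cases h : σ.symm k ∈ T
    · simp [h]
    · simp [h, hpos T hT k]
  have hLsum : ∀ T ∈ 𝒯, ∑ k, L T k = T.card := by
    intro T hT
    have e1 : ∑ k, g T k = ∑ k, (if k ∈ T then g T (σ k) else 0) + T.card := by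
      rw [Finset.card_eq_sum_ones, ← Finset.sum_filter_add_sum_filter_not univ (· ∈ T)]
      have : ∑ k ∈ univ.filter (fun k => k ∉ T), g T k = 0 :=
        Finset.sum_eq_zero fun k hk => by
          rw [hg T hT k, if_neg (Finset.mem_filter.1 hk).2]
      rw [this, ← Finset.sum_filter, Finset.filter_mem_eq_inter, Finset.univ_inter, add_zero,
        ← Finset.sum_add_distrib]
      exact Finset.sum_congr rfl fun k hk => by rw [hg T hT k, if_pos hk]
    have e2 : ∑ k, g T k = ∑ k, (if k ∈ T then g T (σ k) else 0) + ∑ k, L T k := by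
      rw [← Equiv.sum_comp σ (g T), ← Equiv.sum_comp σ (L T), ← Finset.sum_add_distrib]
      refine Finset.sum_congr rfl fun k _ => ?_
      simp only [L, Equiv.symm_apply_apply]
      split_ifs <;> simp
    omega
  have hstart : ∀ T ∈ 𝒯, ∃ k, k ∈ arcStarts σ T := by
    intro T hT
    obtain ⟨hne, hnu⟩ := (Finset.mem_filter.1 hT).2
    by_contra! h
    obtain ⟨k₀, hk₀⟩ : ∃ k, k ∉ T := by
      by_contra! h
      exact hnu (Finset.eq_univ_of_forall h)
    refine hne (Finset.eq_empty_of_forall_notMem fun k => ?_)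
    refine finRotate_induction (P := fun k => k ∉ T) hk₀ (fun k hk hk' => ?_) k
    exact h (σ k) (by
      simp only [arcStarts, Finset.mem_filter, Finset.mem_univ, true_and, Equiv.symm_apply_apply]
      exact ⟨hk', hk⟩)
  have hrec : ∀ T ∈ 𝒯, ∀ k, g T (σ k) = g T k - 1 + L T (σ k) := by
    intro T hT k
    simp only [L, Equiv.symm_apply_apply]
    rw [hg T hT k]
    split_ifs <;> simp
  have hinj : Set.InjOn L (𝒯 : Set (Finset (Fin r))) := by
    intro T hT T' hT' h
    have hT := Finset.mem_coe.1 hT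
    have hT' := Finset.mem_coe.1 hT'
    obtain ⟨k₀, hk₀⟩ := hstart T hT
    have hk₀' : k₀ ∈ arcStarts σ T' := by
      rw [← hL0 T' hT', ← h]
      exact (hL0 T hT k₀).2 hk₀
    have heq : ∀ k, g T k = g T' k := by
      refine finRotate_induction (P := fun k => g T k = g T' k) (k₀ := k₀) ?_ fun k hk => ?_
      · have := congrFun h k₀
        simpa [L, (Finset.mem_filter.1 hk₀).2.2, (Finset.mem_filter.1 hk₀').2.2] using this
      · rw [← hσ, hrec T hT, hrec T' hT', hk, h]
    ext k
    rw [hpos T hT, hpos T' hT', heq]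
  let u : ℕ → ℝ := fun l => if l = 0 then 1 else y * q ^ l
  have hu : ∀ l, 0 ≤ u l := by
    intro l
    simp only [u]
    split_ifs <;> positivity
  have hweight : ∀ T ∈ 𝒯, y ^ (arcStarts σ T).card * q ^ T.card = ∏ k, u (L T k) := by
    intro T hT
    have : ∀ k, u (L T k) = (if k ∈ arcStarts σ T then y else 1) * q ^ L T k := by
      intro k
      by_cases h : L T k = 0
      · have : k ∉ arcStarts σ T := fun hk => (hL0 T hT k).2 hk h
        simp [u, h, this]
      · simp [u, h, (hL0 T hT k).1 h]
    simp_rw [this]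
    rw [Finset.prod_mul_distrib, Finset.prod_pow_eq_pow_sum, hLsum T hT, Finset.prod_ite_mem,
      Finset.univ_inter, Finset.prod_const]
  have hgeom : ∑ l ∈ Finset.range (r + 1), u l ≤ y * q / (1 - q) + 1 := by
    rw [Finset.sum_range_succ']
    simp only [u, Nat.add_eq_zero_iff, one_ne_zero, and_false, if_false, if_true, add_le_add_iff_right]
    rw [← Finset.mul_sum, mul_div_assoc]
    refine mul_le_mul_of_nonneg_left ?_ hy
    simp_rw [pow_succ]
    rw [← Finset.sum_mul, mul_comm, div_eq_mul_inv]
    refine mul_le_mul_of_nonneg_left ?_ hq0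
    rw [← tsum_geometric_of_lt_one hq0 hq1]
    exact (summable_geometric_of_lt_one hq0 hq1).sum_le_tsum _ fun _ _ => by positivity
  calc _ = ∑ f ∈ 𝒯.image L, ∏ k, u (f k) := by
        rw [Finset.sum_image hinj]
        exact Finset.sum_congr rfl hweight
    _ ≤ ∑ f ∈ (Fintype.piFinset fun _ : Fin r => Finset.range (r + 1)).erase 0, ∏ k, u (f k) := by
        refine Finset.sum_le_sum_of_subset_of_nonneg ?_
          fun f _ _ => Finset.prod_nonneg fun k _ => hu _
        intro f hf
        obtain ⟨T, hT, rfl⟩ := Finset.mem_image.1 hf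
        rw [Finset.mem_erase, Fintype.mem_piFinset]
        refine ⟨fun h => ?_, fun k => ?_⟩
        · obtain ⟨k, hk⟩ := hstart T hT
          exact (hL0 T hT k).2 hk (congrFun h k)
        · have h1 := Finset.single_le_sum (f := L T) (fun _ _ => Nat.zero_le _) (Finset.mem_univ k)
          have h2 := Finset.card_le_univ T
          rw [hLsum T hT] at h1
          rw [Fintype.card_fin] at h2
          exact Finset.mem_range.2 (by omega)
    _ = (∑ l ∈ Finset.range (r + 1), u l) ^ r - 1 := by
        rw [Finset.sum_erase_eq_sub (by simp [Fintype.mem_piFinset]), ← Finset.prod_univ_sum]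
        simp [u]
    _ ≤ (y * q / (1 - q) + 1) ^ r - 1 := by
        gcongr
    _ ≤ Real.exp (y * q / (1 - q)) ^ r - 1 := by
        have : 0 < 1 - q := by linarith
        gcongr
        exact Real.add_one_le_exp _
    _ = _ := by rw [← Real.exp_nat_mul]

theorem sum_shared_weight_le {N r : ℕ} (hr : 1 ≤ r) {a b : Fin N → ℝ} {S M₁ M₂ : ℝ}
    (ha : ∀ i, 0 ≤ a i) (hb : ∀ i, 0 ≤ b i) (hS : 0 < S) (hM₁ : ∀ i, a i ≤ M₁)
    (hM₂ : ∀ i, b i ≤ M₂) {d : ℝ} (hd : d = (∑ i, a i * b i) / S) (hd1 : 1 < d)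
    {c : Fin r → Fin N} (hc : Function.Injective c) :
    ∑ c' ∈ univ.filter (fun c' : Fin r → Fin N => sharedPositions (finRotate r) c c' ≠ ∅),
      ∏ k, (if k ∈ sharedPositions (finRotate r) c c' then 1
        else b (c' k) * a (c' (finRotate r k)) / S) ≤
      r + d ^ r * (Real.exp (r * (r * M₁ * M₂ / (S * d) * d⁻¹ / (1 - d⁻¹))) - 1) := by
  have hd0 : 0 < d := by linarith
  have v₀ := c ⟨0, hr⟩
  have hM₁0 : 0 ≤ M₁ := (ha v₀).trans (hM₁ v₀)
  have hM₂0 : 0 ≤ M₂ := (hb v₀).trans (hM₂ v₀)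
  set sh := sharedPositions (finRotate r) c with hsh
  let W : Finset (Fin r) → ℝ := fun T => ∑ c' ∈ univ.filter (fun c' => sh c' = T),
    ∏ k, (if k ∈ T then 1 else b (c' k) * a (c' (finRotate r k)) / S)
  have hmaps : ∀ c' ∈ univ.filter (fun c' => sh c' ≠ ∅),
      sh c' ∈ insert univ (univ.filter (fun T : Finset (Fin r) => T ≠ ∅ ∧ T ≠ univ)) := by
    intro c' h
    have := (Finset.mem_filter.1 h).2
    by_cases hu : sh c' = univ <;> simp [hu, this]
  rw [← Finset.sum_fiberwise_of_maps_to hmaps, Finset.sum_insert (by simp)]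
  have hW : ∀ T : Finset (Fin r), T ≠ ∅ →
      ∑ c' ∈ (univ.filter (fun c' => sh c' ≠ ∅)).filter (fun c' => sh c' = T),
        ∏ k, (if k ∈ sh c' then 1 else b (c' k) * a (c' (finRotate r k)) / S) = W T := by
    intro T hT
    have : (univ.filter (fun c' => sh c' ≠ ∅)).filter (fun c' => sh c' = T)
        = univ.filter (fun c' => sh c' = T) := by
      rw [Finset.filter_filter]
      refine Finset.filter_congr fun c' _ => ⟨fun h => h.2, fun h => ⟨h ▸ hT, h⟩⟩
    rw [this]
    refine Finset.sum_congr rfl fun c' h => ?_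
    rw [(Finset.mem_filter.1 h).2]
  have hne : (univ : Finset (Fin r)) ≠ ∅ :=
    Finset.nonempty_iff_ne_empty.1 ⟨⟨0, hr⟩, Finset.mem_univ _⟩
  rw [hW _ hne]
  refine add_le_add ?_ ?_
  · have : W univ = (univ.filter fun c' => sh c' = univ).card := by simp [W]
    rw [this]
    exact_mod_cast card_shared_univ_le hr hc
  · calc _ ≤ ∑ T ∈ univ.filter (fun T : Finset (Fin r) => T ≠ ∅ ∧ T ≠ univ),
          d ^ r * ((r * M₁ * M₂ / (S * d)) ^ (arcStarts (finRotate r) T).card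
            * d⁻¹ ^ T.card) := by
          refine Finset.sum_le_sum fun T hT => ?_
          obtain ⟨h1, h2⟩ := (Finset.mem_filter.1 hT).2
          rw [hW T h1]
          exact sum_shared_eq_le ha hb hS hM₁ hM₂ hd hd0 hc h2
      _ ≤ _ := by
          rw [← Finset.mul_sum]
          refine mul_le_mul_of_nonneg_left ?_ (by positivity)
          exact sum_arcs_le (by positivity) (by positivity) (inv_lt_one_of_one_lt₀ hd1)

/-- In the directed Chung-Lu model with `a·b/S > 1`,
`Var(SC_r) ≤ E[SC_r] [r + (a·b/S)^r (exp(p_max (rS/(a·b))²/(1 - S/(a·b))) - 1)]`. -/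
theorem simple_cycles_variance_upper_bound
    (N : ℕ) (a b : Fin N → ℝ) (ha : ∀ i, 0 ≤ a i) (hb : ∀ i, 0 ≤ b i)
    (S : ℝ) (hS : 0 < S) (hSa : ∑ i, a i = S) (hSb : ∑ i, b i = S)
    (hmax : ∀ i j, a i * b j ≤ S)
    (pmax : ℝ) (hpmax : IsGreatest {x : ℝ | ∃ i j, x = b i * a j / S} pmax)
    (hd : 1 < (∑ i, a i * b i) / S)
    (r : ℕ) (hr : 1 ≤ r) :
    varOf N (fun i j => b i * a j / S) (fun ω => (simpleCycleCount N r ω : ℝ)) ≤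
      expect N (fun i j => b i * a j / S) (fun ω => (simpleCycleCount N r ω : ℝ)) *
        ((r : ℝ) + ((∑ i, a i * b i) / S) ^ r *
          (Real.exp (pmax * ((r : ℝ) * S / (∑ i, a i * b i)) ^ 2 /
              (1 - S / (∑ i, a i * b i))) - 1)) := by
  have hN : (univ : Finset (Fin N)).Nonempty := by
    by_contra h
    rw [Finset.not_nonempty_iff_eq_empty] at h
    rw [h, Finset.sum_empty] at hSa
    exact hS.ne hSa
  obtain ⟨i₁, -, hM₁⟩ := Finset.exists_max_image univ a hN
  obtain ⟨i₂, -, hM₂⟩ := Finset.exists_max_image univ b hN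
  have hp : pmax = b i₂ * a i₁ / S := by
    obtain ⟨⟨i, j, hij⟩, hub⟩ := hpmax
    refine le_antisymm ?_ (hub ⟨i₂, i₁, rfl⟩)
    have h1 := hM₁ j (Finset.mem_univ _)
    have h2 := hM₂ i (Finset.mem_univ _)
    have h3 := ha j
    have h4 := hb i₂
    rw [hij]
    gcongr
  obtain ⟨d, hd_def⟩ : ∃ d, d = (∑ i, a i * b i) / S := ⟨_, rfl⟩
  rw [← hd_def] at hd ⊢
  have hd0 : 0 < d := by linarith
  have hab : ∑ i, a i * b i = d * S := by rw [hd_def, div_mul_cancel₀ _ hS.ne']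
  have hexp : pmax * ((r : ℝ) * S / (∑ i, a i * b i)) ^ 2 / (1 - S / (∑ i, a i * b i))
      = r * (r * a i₁ * b i₂ / (S * d) * d⁻¹ / (1 - d⁻¹)) := by
    have hq : S / (d * S) = d⁻¹ := by field_simp
    rw [hab, hq, hp, mul_div_assoc']
    congr 1
    field_simp
  rw [hexp, varOf_simpleCycleCount, expect_simpleCycleCount, Finset.sum_mul]
  set σ := finRotate r
  have hpnn : ∀ i j, 0 ≤ b i * a j / S := fun i j =>
    div_nonneg (mul_nonneg (hb i) (ha j)) hS.le
  have hPnn : ∀ F : Finset (Fin N × Fin N), 0 ≤ ∏ e ∈ F, b e.1 * a e.2 / S :=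
    fun F => Finset.prod_nonneg fun e _ => hpnn _ _
  refine Finset.sum_le_sum fun c hc => ?_
  have hcinj := (Finset.mem_filter.1 hc).2
  refine le_trans ?_ (mul_le_mul_of_nonneg_left (sum_shared_weight_le hr ha hb hS
    (fun i => hM₁ i (Finset.mem_univ _)) (fun i => hM₂ i (Finset.mem_univ _)) hd_def hd hcinj)
    (hPnn _))
  rw [Finset.mul_sum, Finset.sum_filter, Finset.sum_filter]
  refine Finset.sum_le_sum fun c' _ => ?_
  have hR : 0 ≤ (∏ e ∈ edgeSet σ c, b e.1 * a e.2 / S) *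
      ∏ k, (if k ∈ sharedPositions σ c c' then 1 else b (c' k) * a (c' (σ k)) / S) :=
    mul_nonneg (hPnn _) (Finset.prod_nonneg fun k _ => by
      split_ifs
      · exact zero_le_one
      · exact hpnn _ _)
  by_cases hinj : Function.Injective c'
  · rw [if_pos hinj, ← Finset.union_sdiff_self_eq_union,
      Finset.prod_union Finset.disjoint_sdiff]
    by_cases hsh : sharedPositions σ c c' = ∅
    · have hdisj : edgeSet σ c' \ edgeSet σ c = edgeSet σ c' := by
        refine Finset.sdiff_eq_self_of_disjoint (Finset.disjoint_left.2 fun e he he' => ?_)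
        obtain ⟨k, rfl⟩ := mem_edgeSet.1 he
        have : k ∈ sharedPositions σ c c' := by
          simpa [sharedPositions] using he'
        simp [hsh] at this
      rw [if_neg (not_not.2 hsh), hdisj, sub_self]
    · rw [if_pos hsh, prod_edgeSet_sdiff σ (fun i j => b i * a j / S) c c' hinj]
      exact sub_le_self _ (mul_nonneg (hPnn _) (hPnn _))
  · rw [if_neg hinj]
    split_ifs
    · exact hR
    · exact le_rfl
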